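/- There exist constants c₁, c₂ > 0 such that for every n ≥ 4, the prices of anarchy of the SUM and MAX swap games on n-vertex trees by weakly pessimistic players with 2-local information satisfy c₁·n ≤ PoA_SUM(n, n−1, 2) ≤ c₂·n and c₁·n ≤ PoA_MAX(n, n−1, 2) ≤ c₂·n. -/

import Mathlib

open SimpleGraph

namespace SwapGame

/-- The set of vertices within distance `k` of `u` in `G` (the `k`-neighborhood). -/
def ball {V : Type} (G : SimpleGraph V) (u : V) (k : ℕ) : Set V :=
  {v | G.edist u v ≤ (k : ℕ∞)}

/-- The graph obtained from `G` by the edge swap `(v, w)` at `u`: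
remove the edge `{u, v}` and add the edge `{u, w}`. -/
def swapGraph {V : Type} (G : SimpleGraph V) (u v w : V) : SimpleGraph V :=
  SimpleGraph.fromEdgeSet ((G.edgeSet \ {s(u, v)}) ∪ {s(u, w)})

/-- The edge swap `(v, w)` at `u` is a legal move for a player with `k`-local information:
`v` is a neighbor of `u` and `w` is a non-neighbor (other than `u`) within distance `k`. -/
def ValidSwap {V : Type} (G : SimpleGraph V) (k : ℕ) (u v w : V) : Prop :=
  G.Adj u v ∧ G.edist u w ≤ (k : ℕ∞) ∧ ¬ G.Adj u w ∧ w ≠ u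

/-- `H` (a graph on `W`, with `ι` identifying the view inside `H`) is a finite connected
graph compatible with `u`'s `k`-local view in `G`. -/
def Compatible {V : Type} (G : SimpleGraph V) (k : ℕ) (u : V)
    {W : Type} (H : SimpleGraph W) (ι : V → W) : Prop :=
  Finite W ∧ H.Connected ∧ Set.InjOn ι (ball G u k) ∧
  {x : W | H.edist (ι u) x ≤ (k : ℕ∞)} = ι '' ball G u k ∧
  ∀ a ∈ ball G u k, ∀ b ∈ ball G u k, (H.Adj (ι a) (ι b) ↔ G.Adj a b)

/-- SUM-cost of player `u` in `H` (`⊤` when `H` is disconnected). -/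
noncomputable def cSum {W : Type} (H : SimpleGraph W) (u : W) : ℕ∞ :=
  ∑' v, H.edist u v

/-- MAX-cost (eccentricity) of player `u` in `H` (`⊤` when `H` is disconnected). -/
noncomputable def cMax {W : Type} (H : SimpleGraph W) (u : W) : ℕ∞ :=
  ⨆ v, H.edist u v

/-- A pessimistic player `u` with `k`-local information is unhappy in `G` w.r.t. the
SUM-cost via the edge swap `(v, w)`: the swap strictly decreases `u`'s cost in every
compatible global graph. -/
def UnhappySumVia {V : Type} (G : SimpleGraph V) (k : ℕ) (u v w : V) : Prop :=
  ValidSwap G k u v w ∧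
  ∀ (W : Type) (H : SimpleGraph W) (ι : V → W), Compatible G k u H ι →
    cSum (swapGraph H (ι u) (ι v) (ι w)) (ι u) < cSum H (ι u)

/-- Pessimistic unhappiness w.r.t. the MAX-cost via the edge swap `(v, w)`. -/
def UnhappyMaxVia {V : Type} (G : SimpleGraph V) (k : ℕ) (u v w : V) : Prop :=
  ValidSwap G k u v w ∧
  ∀ (W : Type) (H : SimpleGraph W) (ι : V → W), Compatible G k u H ι →
    cMax (swapGraph H (ι u) (ι v) (ι w)) (ι u) < cMax H (ι u)

/-- Weakly pessimistic unhappiness w.r.t. the SUM-cost via the edge swap `(v, w)`: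
the swap does not increase `u`'s cost in any compatible global graph. -/
def WeakUnhappySumVia {V : Type} (G : SimpleGraph V) (k : ℕ) (u v w : V) : Prop :=
  ValidSwap G k u v w ∧
  ∀ (W : Type) (H : SimpleGraph W) (ι : V → W), Compatible G k u H ι →
    cSum (swapGraph H (ι u) (ι v) (ι w)) (ι u) ≤ cSum H (ι u)

/-- Weakly pessimistic unhappiness w.r.t. the MAX-cost via the edge swap `(v, w)`. -/
def WeakUnhappyMaxVia {V : Type} (G : SimpleGraph V) (k : ℕ) (u v w : V) : Prop :=
  ValidSwap G k u v w ∧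
  ∀ (W : Type) (H : SimpleGraph W) (ι : V → W), Compatible G k u H ι →
    cMax (swapGraph H (ι u) (ι v) (ι w)) (ι u) ≤ cMax H (ι u)

/-- Optimistic unhappiness w.r.t. the SUM-cost via the edge swap `(v, w)`:
the swap strictly decreases `u`'s cost in some compatible global graph
(with the swapped graph connected). -/
def OptUnhappySumVia {V : Type} (G : SimpleGraph V) (k : ℕ) (u v w : V) : Prop :=
  ValidSwap G k u v w ∧
  ∃ (W : Type) (H : SimpleGraph W) (ι : V → W), Compatible G k u H ι ∧
    (swapGraph H (ι u) (ι v) (ι w)).Connected ∧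
    cSum (swapGraph H (ι u) (ι v) (ι w)) (ι u) < cSum H (ι u)

/-- Optimistic unhappiness w.r.t. the MAX-cost via the edge swap `(v, w)`. -/
def OptUnhappyMaxVia {V : Type} (G : SimpleGraph V) (k : ℕ) (u v w : V) : Prop :=
  ValidSwap G k u v w ∧
  ∃ (W : Type) (H : SimpleGraph W) (ι : V → W), Compatible G k u H ι ∧
    (swapGraph H (ι u) (ι v) (ι w)).Connected ∧
    cMax (swapGraph H (ι u) (ι v) (ι w)) (ι u) < cMax H (ι u)

/-- Sum-swap equilibrium for pessimistic players with `k`-local information. -/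
def SumEquilibrium {V : Type} (G : SimpleGraph V) (k : ℕ) : Prop :=
  ∀ u : V, ¬ ∃ v w, UnhappySumVia G k u v w

/-- Max-swap equilibrium for pessimistic players with `k`-local information. -/
def MaxEquilibrium {V : Type} (G : SimpleGraph V) (k : ℕ) : Prop :=
  ∀ u : V, ¬ ∃ v w, UnhappyMaxVia G k u v w

/-- Sum-swap equilibrium for weakly pessimistic players with `k`-local information. -/
def WeakSumEquilibrium {V : Type} (G : SimpleGraph V) (k : ℕ) : Prop :=
  ∀ u : V, ¬ ∃ v w, WeakUnhappySumVia G k u v w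

/-- Max-swap equilibrium for weakly pessimistic players with `k`-local information. -/
def WeakMaxEquilibrium {V : Type} (G : SimpleGraph V) (k : ℕ) : Prop :=
  ∀ u : V, ¬ ∃ v w, WeakUnhappyMaxVia G k u v w

/-- Sum-swap equilibrium for optimistic players with `k`-local information. -/
def OptSumEquilibrium {V : Type} (G : SimpleGraph V) (k : ℕ) : Prop :=
  ∀ u : V, ¬ ∃ v w, OptUnhappySumVia G k u v w

/-- Max-swap equilibrium for optimistic players with `k`-local information. -/
def OptMaxEquilibrium {V : Type} (G : SimpleGraph V) (k : ℕ) : Prop :=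
  ∀ u : V, ¬ ∃ v w, OptUnhappyMaxVia G k u v w

/-- Social SUM-cost of a (connected, finite) graph, as a natural number. -/
noncomputable def scSum {W : Type} [Fintype W] (H : SimpleGraph W) : ℕ :=
  ∑ u : W, ∑ v : W, H.dist u v

/-- Social MAX-cost of a (connected, finite) graph, as a natural number. -/
noncomputable def scMax {W : Type} [Fintype W] (H : SimpleGraph W) : ℕ :=
  ∑ u : W, Finset.univ.sup (H.dist u)

/-- Price of anarchy over `n`-vertex trees for a given notion of equilibrium and
social cost: (max social cost of an equilibrium tree) / (min social cost of a tree). -/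
noncomputable def PoA (n : ℕ) (eqPred : SimpleGraph (Fin n) → Prop)
    (sc : SimpleGraph (Fin n) → ℕ) : ℚ :=
  ((sSup {m : ℕ | ∃ T : SimpleGraph (Fin n), T.IsTree ∧ eqPred T ∧ sc T = m} : ℕ) : ℚ) /
  ((sInf {m : ℕ | ∃ T : SimpleGraph (Fin n), T.IsTree ∧ sc T = m} : ℕ) : ℚ)

lemma swapGraph_adj {V : Type} (G : SimpleGraph V) (u v w a b : V) :
    (swapGraph G u v w).Adj a b ↔
      ((G.Adj a b ∧ s(a, b) ≠ s(u, v)) ∨ s(a, b) = s(u, w)) ∧ a ≠ b := by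
  simp only [swapGraph, fromEdgeSet_adj, Set.mem_union, Set.mem_sdiff, mem_edgeSet,
    Set.mem_singleton_iff, ne_eq]

lemma edist_le_two_iff {V : Type} (G : SimpleGraph V) (u y : V) :
    G.edist u y ≤ 2 ↔ y = u ∨ G.Adj u y ∨ ∃ z, G.Adj u z ∧ G.Adj z y := by
  constructor
  · intro h
    obtain ⟨p, hp⟩ := exists_walk_of_edist_ne_top (h.trans_lt (by decide)).ne
    rw [← hp] at h
    have h2 : p.length ≤ 2 := by exact_mod_cast h
    match p, h2 with
    | .nil, _ => exact .inl rfl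
    | .cons h .nil, _ => exact .inr (.inl h)
    | .cons h (.cons h' .nil), _ => exact .inr (.inr ⟨_, h, h'⟩)
  · rintro (rfl | h | ⟨z, h, h'⟩)
    · simp
    · exact (edist_eq_one_iff_adj.2 h).le.trans (by decide)
    · exact edist_le (.cons h (.cons h' .nil))

lemma le_edist_of_add_one {V : Type} {G : SimpleGraph V} {u y : V} {k : ℕ}
    (h : ¬ G.edist u y ≤ k) : ((k + 1 : ℕ) : ℕ∞) ≤ G.edist u y := by
  have := Order.add_one_le_of_lt (not_le.1 h)
  exact_mod_cast this

lemma cSum_ne_top {W : Type} [Finite W] {H : SimpleGraph W} (hH : H.Connected) (u : W) :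
    cSum H u ≠ ⊤ := by
  have := Fintype.ofFinite W
  rw [cSum, tsum_fintype]
  exact (WithTop.sum_ne_top.2 fun v _ => edist_ne_top_iff_reachable.2 (hH u v))

lemma dist_lt_card {W : Type} [Fintype W] {H : SimpleGraph W} (hH : H.Connected) (u v : W) :
    H.dist u v < Fintype.card W := by
  obtain ⟨p, hp, hl⟩ := hH.exists_path_of_dist u v
  exact hl ▸ hp.length_lt

lemma cMax_ne_top {W : Type} [Finite W] {H : SimpleGraph W} (hH : H.Connected) (u : W) :
    cMax H u ≠ ⊤ := by
  have := Fintype.ofFinite W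
  have h : cMax H u ≤ (Fintype.card W : ℕ∞) := iSup_le fun v => by
    rw [← (hH u v).coe_dist_eq_edist]
    exact_mod_cast (dist_lt_card hH u v).le
  exact (h.trans_lt (ENat.natCast_lt_top _)).ne

lemma not_reachable_swapGraph {V : Type} {T : SimpleGraph V} (hT : T.IsTree) {u v z w : V}
    (huv : T.Adj u v) (huz : T.Adj u z) (hzw : T.Adj z w) (hzv : z ≠ v) (hwu : w ≠ u) :
    ¬ (swapGraph T u v w).Reachable u v := by
  intro hr
  have hb : ¬ (T.deleteEdges {s(u, v)}).Reachable u v :=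
    isBridge_iff.1 (isAcyclic_iff_forall_adj_isBridge.1 hT.isAcyclic huv)
  have huw : (T.deleteEdges {s(u, v)}).Reachable u w := by
    refine .trans (Adj.reachable (v := z) ?_) (Adj.reachable ?_)
    · simp [deleteEdges_adj, huz, hzv, huv.ne]
    · simp [deleteEdges_adj, hzw, hzv, huz.ne']
  have hadj : ∀ a b, (swapGraph T u v w).Adj a b → (T.deleteEdges {s(u, v)}).Reachable a b := by
    intro a b h
    obtain ⟨⟨h, h'⟩ | h, -⟩ := (swapGraph_adj T u v w a b).1 h
    · exact Adj.reachable (by simpa only [deleteEdges_adj, Set.mem_singleton_iff] using ⟨h, h'⟩)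
    · obtain ⟨rfl, rfl⟩ | ⟨rfl, rfl⟩ := Sym2.eq_iff.1 h
      · exact huw
      · exact huw.symm
  have hwalk : ∀ a b, (swapGraph T u v w).Walk a b → (T.deleteEdges {s(u, v)}).Reachable a b := by
    intro a b p
    induction p with
    | nil => rfl
    | cons h q ih => exact (hadj _ _ h).trans ih
  exact hr.elim fun p => hb (hwalk _ _ p)

lemma compatible_id {V : Type} [Finite V] {T : SimpleGraph V} (hT : T.Connected) (k : ℕ) (u : V) :
    Compatible T k u T id :=
  ⟨inferInstance, hT, Set.injOn_id _, by simp [ball], by simp⟩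

lemma exists_compatible_ball {V : Type} [Finite V] (T : SimpleGraph V) (u : V) :
    ∃ ι : V → ball T u 2, Compatible T 2 u (T.induce (ball T u 2)) ι ∧
      ∀ x (hx : x ∈ ball T u 2), ι x = ⟨x, hx⟩ := by
  classical
  have hu : u ∈ ball T u 2 := by simp [ball]
  refine ⟨fun x => if h : x ∈ ball T u 2 then ⟨x, h⟩ else ⟨u, hu⟩, ?_, fun x hx => dif_pos hx⟩
  have hd : ∀ x, (T.induce (ball T u 2)).edist ⟨u, hu⟩ x ≤ 2 := by
    rintro ⟨x, hx⟩
    rw [edist_le_two_iff]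
    obtain rfl | h | ⟨z, h, h'⟩ := (edist_le_two_iff T u x).1 hx
    · simp
    · exact .inr (.inl h)
    · exact .inr (.inr ⟨⟨z, (edist_le_two_iff T u z).2 (.inr (.inl h))⟩, h, h'⟩)
  refine ⟨inferInstance, ?_, ?_, ?_, ?_⟩
  · rw [connected_iff_exists_forall_reachable]
    exact ⟨⟨u, hu⟩, fun x => reachable_of_edist_ne_top ((hd x).trans_lt (by decide)).ne⟩
  · intro a ha b hb h
    simpa [ha, hb] using h
  · ext ⟨x, hx⟩
    simp only [dif_pos hu, Set.mem_ofPred_eq, Set.mem_image]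
    exact ⟨fun _ => ⟨x, hx, dif_pos hx⟩, fun _ => hd _⟩
  · intro a ha b hb
    simp [ha, hb]

/-- Inside the ball of radius two around `u`, swapping `v` for a neighbor `w` of `v` pushes every
other neighbor of `v` to distance at least three. -/
lemma edist_swapGraph_induce {V : Type} {T : SimpleGraph V} (hT : T.IsAcyclic) {u v w x : V}
    (huv : T.Adj u v) (hvw : T.Adj v w) (hvx : T.Adj v x) (hwu : w ≠ u) (hxu : x ≠ u)
    (hxw : x ≠ w) (huw : ¬ T.Adj u w)
    (hu : u ∈ ball T u 2) (hv : v ∈ ball T u 2) (hw : w ∈ ball T u 2) (hx : x ∈ ball T u 2) :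
    3 ≤ (swapGraph (T.induce (ball T u 2)) ⟨u, hu⟩ ⟨v, hv⟩ ⟨w, hw⟩).edist ⟨u, hu⟩ ⟨x, hx⟩ := by
  have hb : ∀ {a b}, T.Adj a b → ¬ (T.deleteEdges {s(a, b)}).Reachable a b := fun h =>
    isBridge_iff.1 (isAcyclic_iff_forall_adj_isBridge.1 hT h)
  have hux : ¬ T.Adj u x := by
    intro h
    refine hb h (.trans (Adj.reachable (v := v) ?_) (Adj.reachable ?_))
    · simp [deleteEdges_adj, huv, hvx.ne, hxu.symm]
    · simp [deleteEdges_adj, hvx, huv.ne', hvx.ne]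
  have hwx : ¬ T.Adj w x := by
    intro h
    refine hb h (.trans (Adj.reachable (v := v) ?_) (Adj.reachable ?_))
    · simp [deleteEdges_adj, hvw.symm, hvx.ne, hxw.symm]
    · simp [deleteEdges_adj, hvx, hvw.ne, hvx.ne]
  refine le_edist_of_add_one (k := 2) fun h => ?_
  obtain h | h | ⟨⟨y, hy⟩, h, h'⟩ := (edist_le_two_iff _ _ _).1 h
  · simp [hxu] at h
  · simp [swapGraph_adj, hux, hxw, hxu] at h
  · simp only [swapGraph_adj, comap_adj, Function.Embedding.subtype_apply, ne_eq, Sym2.eq_iff,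
      Subtype.mk.injEq] at h h'
    have hyw : y ≠ w := by rintro rfl; simp_all
    have huy : T.Adj u y ∧ y ≠ v := by
      have := huv.ne
      grind
    have hyx : T.Adj y x := by grind
    refine hb huv (.trans (Adj.reachable (v := y) ?_) (.trans (Adj.reachable (v := x) ?_)
      (Adj.reachable ?_)))
    · simp [deleteEdges_adj, huy, huv.ne]
    · simp [deleteEdges_adj, hyx, huy.2, huy.1.ne']
    · simp [deleteEdges_adj, hvx.symm, hxu, hvx.ne']

theorem weakEquilibrium_of_degree_ne_two {V : Type} [Finite V] {T : SimpleGraph V}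
    (hT : T.IsTree)
    (hdeg : ∀ v u w, T.Adj v u → T.Adj v w → w ≠ u → ∃ x, T.Adj v x ∧ x ≠ u ∧ x ≠ w) :
    WeakSumEquilibrium T 2 ∧ WeakMaxEquilibrium T 2 := by
  suffices key : ∀ u v w, ValidSwap T 2 u v w → ∃ (W : Type) (H : SimpleGraph W) (ι : V → W),
      Compatible T 2 u H ι ∧
      cSum H (ι u) < cSum (swapGraph H (ι u) (ι v) (ι w)) (ι u) ∧
      cMax H (ι u) < cMax (swapGraph H (ι u) (ι v) (ι w)) (ι u) by
    constructor
    · rintro u ⟨v, w, hs, h⟩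
      obtain ⟨W, H, ι, hc, h1, h2⟩ := key u v w hs
      exact (h W H ι hc).not_gt h1
    · rintro u ⟨v, w, hs, h⟩
      obtain ⟨W, H, ι, hc, h1, h2⟩ := key u v w hs
      exact (h W H ι hc).not_gt h2
  rintro u v w ⟨huv, hd, hnuw, hwu⟩
  obtain h | h | ⟨z, huz, hzw⟩ := (edist_le_two_iff T u w).1 hd
  · exact absurd h hwu
  · exact absurd h hnuw
  obtain hzv | rfl := ne_or_eq z v
  · refine ⟨V, T, id, compatible_id hT.connected 2 u, ?_⟩
    have h := edist_eq_top_of_not_reachable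
      (not_reachable_swapGraph hT huv huz hzw hzv hwu)
    constructor
    · refine (cSum_ne_top hT.connected u).lt_top.trans_le ?_
      rw [← h]
      have := Fintype.ofFinite V
      rw [cSum, tsum_fintype]
      exact Finset.single_le_sum (f := fun y => (swapGraph T u v w).edist u y)
        (fun _ _ => zero_le) (Finset.mem_univ v)
    · refine (cMax_ne_top hT.connected u).lt_top.trans_le ?_
      rw [← h]
      exact le_iSup (fun y => (swapGraph T u v w).edist u y) v
  · obtain ⟨x, hzx, hxu, hxw⟩ := hdeg z u w huv.symm hzw hwu
    obtain ⟨ι, hc, hι⟩ := exists_compatible_ball T u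
    have hB : ∀ y, y = u ∨ T.Adj u y ∨ (∃ z, T.Adj u z ∧ T.Adj z y) → y ∈ ball T u 2 :=
      fun y hy => (edist_le_two_iff T u y).2 hy
    have hu : u ∈ ball T u 2 := hB u (.inl rfl)
    have hz : z ∈ ball T u 2 := hB z (.inr (.inl huv))
    have hw : w ∈ ball T u 2 := hB w (.inr (.inr ⟨z, huv, hzw⟩))
    have hx : x ∈ ball T u 2 := hB x (.inr (.inr ⟨z, huv, hzx⟩))
    have h3 := edist_swapGraph_induce hT.isAcyclic huv hzw hzx hwu hxu hxw hnuw hu hz hw hx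
    refine ⟨_, _, ι, hc, ?_⟩
    have hle : ∀ y, (T.induce (ball T u 2)).edist (ι u) y ≤ 2 := by
      intro y
      have := hc.2.2.2.1.ge ⟨y, y.2, hι y y.2⟩
      exact this
    have hcon := hc.2.1
    rw [hι u hu] at hle
    rw [hι u hu, hι z hz, hι w hw]
    constructor
    · have := Fintype.ofFinite (ball T u 2)
      classical
      have hpt : ∀ y, (T.induce (ball T u 2)).edist ⟨u, hu⟩ y + (if y = ⟨z, hz⟩ then 1 else 0) +
          (if y = ⟨x, hx⟩ then 1 else 0) ≤
          (swapGraph (T.induce (ball T u 2)) ⟨u, hu⟩ ⟨z, hz⟩ ⟨w, hw⟩).edist ⟨u, hu⟩ y +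
          (if y = ⟨w, hw⟩ then 1 else 0) := by
        rintro ⟨y, hy⟩
        have hyu : y ≠ u → 1 ≤ (swapGraph (T.induce (ball T u 2)) ⟨u, hu⟩ ⟨z, hz⟩ ⟨w, hw⟩).edist
            ⟨u, hu⟩ ⟨y, hy⟩ := fun h =>
          Order.one_le_iff_pos.2 (edist_pos_of_ne (by simpa using h.symm))
        have hnadj : y ≠ u → y ≠ w → (y = z ∨ ¬ T.Adj u y) →
            2 ≤ (swapGraph (T.induce (ball T u 2)) ⟨u, hu⟩ ⟨z, hz⟩ ⟨w, hw⟩).edist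
              ⟨u, hu⟩ ⟨y, hy⟩ := by
          intro h1 h2 h3
          refine le_edist_of_add_one (k := 1) fun h => ?_
          rw [Nat.cast_one, edist_le_one_iff_adj_or_eq, swapGraph_adj] at h
          simp only [comap_adj, Function.Embedding.subtype_apply, ne_eq, Sym2.eq_iff,
            Subtype.mk.injEq] at h
          grind
        have hly := hle ⟨y, hy⟩
        simp only [Subtype.mk.injEq]
        obtain rfl | hyw := eq_or_ne y w
        · simpa [hzw.ne', hxw.symm, one_add_one_eq_two] using
            hly.trans (one_add_one_eq_two (R := ℕ∞) ▸ add_le_add_left (hyu hwu) 1)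
        obtain rfl | hyz := eq_or_ne y z
        · have h1 : (T.induce (ball T u 2)).edist ⟨u, hu⟩ ⟨y, hy⟩ = 1 :=
            edist_eq_one_iff_adj.2 huv
          simpa [h1, hyw, hzx.ne, one_add_one_eq_two] using hnadj huv.ne' hyw (.inl rfl)
        obtain rfl | hyx := eq_or_ne y x
        · simpa [hyz, hyw] using (add_le_add_left hly 1).trans h3
        simp only [hyz, hyx, hyw, if_false, add_zero]
        obtain rfl | hyu' := eq_or_ne y u
        · simp
        by_cases huy : T.Adj u y
        · exact (edist_eq_one_iff_adj (G := T.induce (ball T u 2)) (u := ⟨u, hu⟩) (v := ⟨y, hy⟩)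
            |>.2 huy).le.trans (hyu hyu')
        · exact hly.trans (hnadj hyu' hyw (.inr huy))
      have hsum := Finset.sum_le_sum fun y (_ : y ∈ Finset.univ) => hpt y
      simp only [Finset.sum_add_distrib, Finset.sum_ite_eq', Finset.mem_univ, if_true] at hsum
      rw [← tsum_fintype (L := .unconditional _), ← tsum_fintype (L := .unconditional _)] at hsum
      by_contra! hlt
      have hfin := cSum_ne_top hcon ⟨u, hu⟩
      change cSum _ _ + 1 + 1 ≤ cSum _ _ + 1 at hsum
      have h4 := hsum.trans (add_le_add_left hlt 1)
      lift cSum (T.induce (ball T u 2)) ⟨u, hu⟩ to ℕ using hfin with m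
      norm_cast at h4
      omega
    · refine (iSup_le hle).trans_lt (lt_of_lt_of_le (by decide) (h3.trans ?_))
      exact le_iSup (fun y => (swapGraph (T.induce (ball T u 2)) ⟨u, hu⟩ ⟨z, hz⟩ ⟨w, hw⟩).edist
        ⟨u, hu⟩ y) _

/-- The graph on `V` in which every vertex is joined to its image under `p`. -/
def parentGraph {V : Type} (p : V → V) : SimpleGraph V :=
  SimpleGraph.fromRel fun a b => p a = b

lemma parentGraph_adj {V : Type} (p : V → V) (a b : V) :
    (parentGraph p).Adj a b ↔ a ≠ b ∧ (p a = b ∨ p b = a) := by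
  simp [parentGraph]

lemma isTree_parentGraph {n : ℕ} (p : Fin n → Fin n) (r : Fin n) (hr : p r = r)
    (hp : ∀ a, a ≠ r → p a < a) : (parentGraph p).IsTree := by
  have hconn : (parentGraph p).Connected := by
    rw [connected_iff_exists_forall_reachable]
    refine ⟨r, fun a => ?_⟩
    induction a using WellFoundedLT.induction with
    | ind a ih =>
      by_cases ha : a = r
      · rw [ha]
      · refine (ih _ (hp a ha)).trans (Adj.reachable ?_)
        rw [parentGraph_adj]
        exact ⟨(hp a ha).ne, .inr rfl⟩
  refine isTree_iff_connected_and_card.2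
    ⟨hconn, le_antisymm ?_ hconn.card_vert_le_card_edgeSet_add_one⟩
  have hsub : (parentGraph p).edgeSet ⊆ (fun a => s(a, p a)) '' {a | a ≠ r} := by
    intro e
    induction e using Sym2.ind with
    | _ a b =>
      rw [mem_edgeSet, parentGraph_adj]
      rintro ⟨hab, h | h⟩
      · exact ⟨a, by rintro rfl; exact hab (hr.symm.trans h), by simp [h]⟩
      · exact ⟨b, by rintro rfl; exact hab (h.symm.trans hr), by simp [h, Sym2.eq_swap]⟩
  have h1 := (Set.ncard_le_ncard hsub).trans (Set.ncard_image_le (Set.toFinite _))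
  have h2 : Set.ncard {a | a ≠ r} + 1 = Nat.card (Fin n) := by
    have := Set.ncard_add_ncard_compl {r}
    rw [Set.ncard_singleton] at this
    rw [← this, add_comm]; rfl
  rw [Nat.card_coe_set_eq]
  omega

lemma abs_sub_le_two_mul_dist {V : Type} {G : SimpleGraph V} (hG : G.Connected) (f : V → ℤ)
    (hf : ∀ a b, G.Adj a b → |f b - f a| ≤ 2) (a b : V) : |f b - f a| ≤ 2 * G.dist a b := by
  obtain ⟨p, hp⟩ := hG.exists_walk_length_eq_dist a b
  rw [← hp]
  clear hp
  induction p with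
  | nil => simp
  | @cons u v w h q ih =>
    have := hf _ _ h
    have := abs_sub_le (f w) (f v) (f u)
    push_cast [Walk.length_cons]
    linarith

/-- The parent function of a caterpillar on `n` vertices whose spine consists of odd vertices. -/
def caterpillarParent (n : ℕ) (hn : 4 ≤ n) (i : Fin n) : Fin n :=
  ⟨if i.1 % 2 = 1 then i.1 - 2 else if i.1 + 1 = n then 1 else i.1 - 1, by
    have := i.2; split_ifs <;> omega⟩

lemma isTree_caterpillar (n : ℕ) (hn : 4 ≤ n) : (parentGraph (caterpillarParent n hn)).IsTree := by
  refine isTree_parentGraph _ ⟨0, by omega⟩ ?_ ?_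
  · simp only [caterpillarParent, Fin.mk.injEq]
    split_ifs <;> omega
  · rintro ⟨a, ha⟩ h
    simp only [ne_eq, Fin.mk.injEq] at h
    simp only [caterpillarParent, Fin.mk_lt_mk]
    split_ifs <;> omega

lemma caterpillar_degree (n : ℕ) (hn : 4 ≤ n) (v u w : Fin n)
    (hu : (parentGraph (caterpillarParent n hn)).Adj v u)
    (hw : (parentGraph (caterpillarParent n hn)).Adj v w) (hwu : w ≠ u) :
    ∃ x, (parentGraph (caterpillarParent n hn)).Adj v x ∧ x ≠ u ∧ x ≠ w := by
  obtain ⟨v, hv⟩ := v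
  obtain ⟨u, hu'⟩ := u
  obtain ⟨w, hw'⟩ := w
  simp only [parentGraph_adj, caterpillarParent, ne_eq, Fin.mk.injEq] at hu hw hwu ⊢
  have hodd : v % 2 = 1 ∧ v + 2 < n := by
    grind
  have key : ∃ x, ∃ hx : x < n, (x = v - 2 ∨ x = v + 1 ∨ x = v + 2) ∧ x ≠ u ∧ x ≠ w := by
    by_cases h1 : v - 2 ≠ u ∧ v - 2 ≠ w
    · exact ⟨v - 2, by omega, by omega, h1⟩
    by_cases h2 : v + 1 ≠ u ∧ v + 1 ≠ w
    · exact ⟨v + 1, by omega, by omega, h2⟩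
    · exact ⟨v + 2, by omega, by omega, by omega, by omega⟩
  obtain ⟨x, hx, h, h1, h2⟩ := key
  refine ⟨⟨x, hx⟩, ?_, by simpa using h1, by simpa using h2⟩
  simp only [Fin.mk.injEq]
  grind

/-- Position along the spine of the caterpillar. -/
def caterpillarHeight (n : ℕ) (i : Fin n) : ℤ :=
  if i.1 % 2 = 0 ∧ i.1 + 1 = n then 1 else i.1

lemma caterpillar_dist (n : ℕ) (hn : 4 ≤ n) (a b : Fin n) :
    |caterpillarHeight n b - caterpillarHeight n a| ≤
      2 * (parentGraph (caterpillarParent n hn)).dist a b := by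
  refine abs_sub_le_two_mul_dist (isTree_caterpillar n hn).connected _ ?_ a b
  rintro ⟨a, ha⟩ ⟨b, hb⟩ h
  simp only [parentGraph_adj, caterpillarParent, ne_eq, Fin.mk.injEq] at h
  simp only [caterpillarHeight, abs_le]
  split_ifs at * <;> omega

lemma scMax_caterpillar (n : ℕ) (hn : 4 ≤ n) :
    n ^ 2 ≤ 8 * scMax (parentGraph (caterpillarParent n hn)) := by
  have h : ∀ u : Fin n, n ≤ 8 * Finset.univ.sup
      ((parentGraph (caterpillarParent n hn)).dist u) := by
    intro u
    have h0 := caterpillar_dist n hn u ⟨0, by omega⟩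
    have h1 := caterpillar_dist n hn u ⟨n - 2, by omega⟩
    have h2 := Finset.le_sup (f := (parentGraph (caterpillarParent n hn)).dist u)
      (Finset.mem_univ ⟨0, by omega⟩)
    have h3 := Finset.le_sup (f := (parentGraph (caterpillarParent n hn)).dist u)
      (Finset.mem_univ ⟨n - 2, by omega⟩)
    simp only [caterpillarHeight, abs_le] at h0 h1
    have := u.2
    split_ifs at h0 h1 <;> omega
  have := Finset.sum_le_sum fun u (_ : u ∈ Finset.univ) => h u
  rw [← Finset.mul_sum] at this
  simpa [scMax, sq] using this

lemma scSum_caterpillar (n : ℕ) (hn : 4 ≤ n) :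
    n ^ 3 ≤ 256 * scSum (parentGraph (caterpillarParent n hn)) := by
  set A := Finset.Iio (⟨(n + 3) / 4, by omega⟩ : Fin n) with hA
  set B := Finset.Ico (⟨(n + 1) / 2, by omega⟩ : Fin n) ⟨n - 1, by omega⟩ with hB
  have hAc : n ≤ 4 * A.card := by rw [hA, Fin.card_Iio]; dsimp only; omega
  have hBc : n ≤ 8 * B.card := by rw [hB, Fin.card_Ico]; dsimp only; omega
  have h : ∀ u ∈ A, ∀ v ∈ B, n ≤ 8 * (parentGraph (caterpillarParent n hn)).dist u v := by
    rintro ⟨u, hu'⟩ hu ⟨v, hv'⟩ hv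
    have h0 := caterpillar_dist n hn ⟨u, hu'⟩ ⟨v, hv'⟩
    simp only [hA, hB, Finset.mem_Iio, Finset.mem_Ico, Fin.mk_lt_mk, Fin.mk_le_mk] at hu hv
    simp only [caterpillarHeight, abs_le] at h0
    split_ifs at h0 <;> omega
  have h1 : A.card * (B.card * n) ≤ 8 * scSum (parentGraph (caterpillarParent n hn)) := by
    calc A.card * (B.card * n) = ∑ u ∈ A, ∑ v ∈ B, n := by simp
      _ ≤ ∑ u ∈ A, ∑ v ∈ B, 8 * (parentGraph (caterpillarParent n hn)).dist u v :=
        Finset.sum_le_sum fun u hu => Finset.sum_le_sum fun v hv => h u hu v hv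
      _ ≤ ∑ u, ∑ v, 8 * (parentGraph (caterpillarParent n hn)).dist u v :=
        (Finset.sum_le_sum fun u _ => Finset.sum_le_sum_of_subset (Finset.subset_univ _)).trans
          (Finset.sum_le_sum_of_subset (Finset.subset_univ _))
      _ = _ := by simp [scSum, Finset.mul_sum]
  calc n ^ 3 = n * (n * n) := by ring
    _ ≤ (4 * A.card) * ((8 * B.card) * n) := by gcongr
    _ = 32 * (A.card * (B.card * n)) := by ring
    _ ≤ 32 * (8 * scSum (parentGraph (caterpillarParent n hn))) := by gcongr
    _ = _ := by ring

lemma exists_star (n : ℕ) (hn : 4 ≤ n) :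
    ∃ T : SimpleGraph (Fin n), T.IsTree ∧ scSum T ≤ 2 * n ^ 2 ∧ scMax T ≤ 2 * n := by
  have : NeZero n := ⟨by omega⟩
  have hT : (parentGraph fun _ : Fin n => (0 : Fin n)).IsTree :=
    isTree_parentGraph _ 0 rfl fun a ha => Fin.pos_iff_ne_zero.2 ha
  have hd : ∀ a b, (parentGraph fun _ : Fin n => (0 : Fin n)).dist a b ≤ 2 := by
    have h0 : ∀ a, (parentGraph fun _ : Fin n => (0 : Fin n)).dist 0 a ≤ 1 := by
      intro a
      obtain rfl | ha := eq_or_ne a 0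
      · simp
      · exact (dist_eq_one_iff_adj.2 ((parentGraph_adj _ _ _).2 ⟨ha.symm, .inr rfl⟩)).le
    intro a b
    have := hT.connected.dist_triangle (u := a) (v := 0) (w := b)
    have := h0 a
    have := h0 b
    rw [dist_comm] at this
    have := dist_comm (G := parentGraph fun _ : Fin n => (0 : Fin n)) (u := a) (v := 0)
    have := dist_comm (G := parentGraph fun _ : Fin n => (0 : Fin n)) (u := b) (v := 0)
    omega
  refine ⟨_, hT, ?_, ?_⟩
  · refine (Finset.sum_le_sum fun a _ => Finset.sum_le_sum fun b _ => hd a b).trans ?_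
    simp only [Finset.sum_const, Finset.card_univ, Fintype.card_fin, smul_eq_mul]
    exact le_of_eq (by ring)
  · refine (Finset.sum_le_sum fun a _ => Finset.sup_le fun b _ => hd a b).trans ?_
    simp [mul_comm]

lemma scSum_bounds {n : ℕ} (hn : 2 ≤ n) {T : SimpleGraph (Fin n)} (hT : T.IsTree) :
    n ^ 2 ≤ 2 * scSum T ∧ scSum T ≤ n ^ 3 := by
  constructor
  · have h1 : ∀ u v : Fin n, 1 ≤ T.dist u v + if v = u then 1 else 0 := by
      intro u v
      split_ifs with h
      · omega
      · exact hT.connected.pos_dist_of_ne (Ne.symm h)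
    have h2 := Finset.sum_le_sum fun u (_ : u ∈ Finset.univ) =>
      Finset.sum_le_sum fun v (_ : v ∈ Finset.univ) => h1 u v
    simp only [Finset.sum_add_distrib, Finset.sum_ite_eq', Finset.mem_univ, if_true,
      Finset.sum_const, Finset.card_univ, Fintype.card_fin, smul_eq_mul, mul_one] at h2
    rw [scSum]
    nlinarith
  · have h1 : ∀ u v : Fin n, T.dist u v ≤ n := fun u v => by
      simpa using (dist_lt_card hT.connected u v).le
    refine (Finset.sum_le_sum fun a _ => Finset.sum_le_sum fun b _ => h1 a b).trans ?_
    simp only [Finset.sum_const, Finset.card_univ, Fintype.card_fin, smul_eq_mul]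
    exact le_of_eq (by ring)

lemma scMax_bounds {n : ℕ} (hn : 2 ≤ n) {T : SimpleGraph (Fin n)} (hT : T.IsTree) :
    n ≤ scMax T ∧ scMax T ≤ n ^ 2 := by
  constructor
  · have h1 : ∀ u : Fin n, 1 ≤ Finset.univ.sup (T.dist u) := by
      intro u
      have : Nontrivial (Fin n) := Fin.nontrivial_iff_two_le.2 (by omega)
      obtain ⟨v, hv⟩ := exists_ne u
      exact (hT.connected.pos_dist_of_ne hv.symm).trans_le
        (Finset.le_sup (f := T.dist u) (Finset.mem_univ v))
    simpa [scMax] using Finset.sum_le_sum fun u (_ : u ∈ Finset.univ) => h1 u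
  · have h1 : ∀ u v : Fin n, T.dist u v ≤ n := fun u v => by
      simpa using (dist_lt_card hT.connected u v).le
    refine (Finset.sum_le_sum fun a _ => Finset.sup_le fun b _ => h1 a b).trans ?_
    simp [sq]

lemma PoA_bounds {n : ℕ} {eqPred : SimpleGraph (Fin n) → Prop} {sc : SimpleGraph (Fin n) → ℕ}
    {lo hi lo' hi' : ℚ} (hlo' : 0 < lo')
    (hsc : ∀ T, T.IsTree → lo' ≤ sc T ∧ sc T ≤ hi)
    {S : SimpleGraph (Fin n)} (hS : S.IsTree) (hSsc : sc S ≤ hi')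
    {C : SimpleGraph (Fin n)} (hC : C.IsTree) (hCeq : eqPred C) (hCsc : lo ≤ sc C) :
    lo / hi' ≤ PoA n eqPred sc ∧ PoA n eqPred sc ≤ hi / lo' := by
  have hinf : lo' ≤ (sInf {m : ℕ | ∃ T : SimpleGraph (Fin n), T.IsTree ∧ sc T = m} : ℕ) := by
    obtain ⟨T, hT, h⟩ : sInf {m : ℕ | ∃ T : SimpleGraph (Fin n), T.IsTree ∧ sc T = m} ∈
        {m : ℕ | ∃ T : SimpleGraph (Fin n), T.IsTree ∧ sc T = m} := Nat.sInf_mem ⟨_, S, hS, rfl⟩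
    exact h ▸ (hsc T hT).1
  have hSmem : sc S ∈ {m : ℕ | ∃ T : SimpleGraph (Fin n), T.IsTree ∧ sc T = m} := ⟨S, hS, rfl⟩
  have hinf' : (sInf {m : ℕ | ∃ T : SimpleGraph (Fin n), T.IsTree ∧ sc T = m} : ℕ) ≤ hi' :=
    (Nat.cast_le.2 (Nat.sInf_le hSmem)).trans hSsc
  have hbdd : BddAbove {m : ℕ | ∃ T : SimpleGraph (Fin n), T.IsTree ∧ eqPred T ∧ sc T = m} := by
    refine ⟨⌊hi⌋₊, ?_⟩
    rintro m ⟨T, hT, -, rfl⟩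
    exact Nat.le_floor (hsc T hT).2
  have hmem : sc C ∈ {m : ℕ | ∃ T : SimpleGraph (Fin n), T.IsTree ∧ eqPred T ∧ sc T = m} :=
    ⟨C, hC, hCeq, rfl⟩
  have hsup := hCsc.trans (Nat.cast_le.2 (le_csSup hbdd hmem))
  have hsup' : (sSup {m : ℕ | ∃ T : SimpleGraph (Fin n), T.IsTree ∧ eqPred T ∧ sc T = m} : ℕ) ≤
      hi := by
    obtain ⟨T, hT, -, h⟩ :
        sSup {m : ℕ | ∃ T : SimpleGraph (Fin n), T.IsTree ∧ eqPred T ∧ sc T = m} ∈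
        {m : ℕ | ∃ T : SimpleGraph (Fin n), T.IsTree ∧ eqPred T ∧ sc T = m} := Nat.sSup_mem (Set.nonempty_of_mem hmem) hbdd
    exact h ▸ (hsc T hT).2
  unfold PoA
  constructor
  · exact div_le_div₀ (Nat.cast_nonneg _) hsup (hlo'.trans_le hinf) hinf'
  · exact div_le_div₀ ((Nat.cast_nonneg _).trans hsup') hsup' hlo' hinf

theorem stmt16 : ∃ c₁ c₂ : ℚ, 0 < c₁ ∧ 0 < c₂ ∧
    ∀ n : ℕ, 4 ≤ n →
      (c₁ * n ≤ PoA n (fun T => WeakSumEquilibrium T 2) scSum ∧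
        PoA n (fun T => WeakSumEquilibrium T 2) scSum ≤ c₂ * n) ∧
      (c₁ * n ≤ PoA n (fun T => WeakMaxEquilibrium T 2) scMax ∧
        PoA n (fun T => WeakMaxEquilibrium T 2) scMax ≤ c₂ * n) := by
  refine ⟨1 / 512, 2, by norm_num, by norm_num, fun n hn => ?_⟩
  have hC := isTree_caterpillar n hn
  obtain ⟨hsum, hmax⟩ := weakEquilibrium_of_degree_ne_two hC (caterpillar_degree n hn)
  obtain ⟨S, hS, hSsum, hSmax⟩ := exists_star n hn
  have hn0 : (0 : ℚ) < n := by exact_mod_cast (by omega : 0 < n)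
  have hCsum : (n : ℚ) ^ 3 ≤ 256 * scSum (parentGraph (caterpillarParent n hn)) := by
    exact_mod_cast scSum_caterpillar n hn
  have hCmax : (n : ℚ) ^ 2 ≤ 8 * scMax (parentGraph (caterpillarParent n hn)) := by
    exact_mod_cast scMax_caterpillar n hn
  constructor
  · have hsc : ∀ T : SimpleGraph (Fin n), T.IsTree →
        (n : ℚ) ^ 2 / 2 ≤ scSum T ∧ (scSum T : ℚ) ≤ n ^ 3 := by
      intro T hT
      have h1 : (n : ℚ) ^ 2 ≤ 2 * scSum T := by exact_mod_cast (scSum_bounds (by omega) hT).1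
      exact ⟨by linarith, by exact_mod_cast (scSum_bounds (by omega) hT).2⟩
    have h := PoA_bounds (eqPred := fun T => WeakSumEquilibrium T 2) (lo := n ^ 3 / 256) (hi' := 2 * n ^ 2) (by positivity)
      hsc hS (by exact_mod_cast hSsum) hC hsum (by linarith)
    have h1 : (n : ℚ) ^ 3 / 256 / (2 * n ^ 2) = 1 / 512 * n := by field_simp; norm_num
    have h2 : (n : ℚ) ^ 3 / (n ^ 2 / 2) = 2 * n := by field_simp
    rw [h1, h2] at h
    exact h
  · have hsc : ∀ T : SimpleGraph (Fin n), T.IsTree →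
        (n : ℚ) ≤ scMax T ∧ (scMax T : ℚ) ≤ n ^ 2 := by
      intro T hT
      exact ⟨by exact_mod_cast (scMax_bounds (by omega) hT).1, by exact_mod_cast (scMax_bounds (by omega) hT).2⟩
    have h := PoA_bounds (eqPred := fun T => WeakMaxEquilibrium T 2) (lo := n ^ 2 / 8) (hi' := 2 * n) hn0
      hsc hS (by exact_mod_cast hSmax) hC hmax (by linarith)
    have h1 : (n : ℚ) ^ 2 / 8 / (2 * n) = 1 / 16 * n := by field_simp; norm_num
    have h2 : (n : ℚ) ^ 2 / n = n := by field_simp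
    rw [h1, h2] at h
    exact ⟨by linarith, by linarith⟩

end SwapGame
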